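/- In the areal interpolation setup at target level, the variance of the dasymetric prediction error satisfies Var(Ŷ^DAX_T − Y_T) = α·|S|·(|T|/|S| − x_T/x_S)² + β·x_T·(1 − x_T/x_S) + α·|T|·(1 − |T|/|S|). -/

import Mathlib

open MeasureTheory ProbabilityTheory

section PoissonMoments

open scoped Nat NNReal

/-- The Stein–Chen identity for the Poisson weights. -/
lemma hasSum_poisson_natCast_mul {r : ℝ≥0} {g : ℕ → ℝ} {a : ℝ}
    (h : HasSum (fun n ↦ Real.exp (-r) * r ^ n / n ! * g (n + 1)) a) :
    HasSum (fun n ↦ Real.exp (-r) * r ^ n / n ! * (n * g n)) (r * a) := by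
  rw [← hasSum_nat_add_iff' 1]
  convert! h.mul_left (r : ℝ) using 1
  · ext n
    rw [Nat.factorial_succ]
    push_cast
    field_simp
    ring
  · simp

lemma hasSum_poisson_natCast (r : ℝ≥0) :
    HasSum (fun n : ℕ ↦ Real.exp (-r) * r ^ n / n ! * (n : ℝ)) r := by
  have h := hasSum_poisson_natCast_mul (g := fun _ ↦ 1) (r := r) (a := 1)
    (by simpa only [mul_one] using hasSum_one_poissonMeasure r)
  rw [mul_one] at h
  simpa only [mul_one] using h

lemma hasSum_poisson_natCast_sq (r : ℝ≥0) :
    HasSum (fun n : ℕ ↦ Real.exp (-r) * r ^ n / n ! * (n : ℝ) ^ 2) (r * (r + 1)) := by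
  simp_rw [pow_two (Nat.cast (R := ℝ) _)]
  refine hasSum_poisson_natCast_mul (g := fun n ↦ (n : ℝ)) ?_
  simpa [mul_add] using (hasSum_poisson_natCast r).add (hasSum_one_poissonMeasure r)

lemma memLp_two_natCast_poissonMeasure (r : ℝ≥0) :
    MemLp (fun n : ℕ ↦ (n : ℝ)) 2 (poissonMeasure r) := by
  rw [memLp_two_iff_integrable_sq .of_discrete, integrable_poissonMeasure_iff]
  simpa using (hasSum_poisson_natCast_sq r).summable

lemma variance_natCast_poissonMeasure (r : ℝ≥0) :
    variance (fun n : ℕ ↦ (n : ℝ)) (poissonMeasure r) = r := by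
  rw [variance_eq_sub (memLp_two_natCast_poissonMeasure r), integral_poissonMeasure,
    integral_poissonMeasure]
  simp only [smul_eq_mul, Pi.pow_apply]
  rw [(hasSum_poisson_natCast r).tsum_eq, (hasSum_poisson_natCast_sq r).tsum_eq]
  ring

variable {Ω : Type*} [MeasurableSpace Ω] {μ : Measure Ω} {Y : Ω → ℕ} {r : ℝ≥0}

lemma memLp_two_of_map_eq_poissonMeasure (hY : Measurable Y) (h : μ.map Y = poissonMeasure r) :
    MemLp (fun ω ↦ (Y ω : ℝ)) 2 μ :=
  (memLp_map_measure_iff .of_discrete hY.aemeasurable).1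
    (h ▸ memLp_two_natCast_poissonMeasure r)

lemma variance_of_map_eq_poissonMeasure (hY : Measurable Y) (h : μ.map Y = poissonMeasure r) :
    variance (fun ω ↦ (Y ω : ℝ)) μ = r := by
  rw [← variance_natCast_poissonMeasure r, ← h, variance_map .of_discrete hY.aemeasurable]
  rfl

end PoissonMoments

/-- The variance of the dasymetric prediction error satisfies
`Var(Ŷ^DAX_T − Y_T) = α·|S|·(|T|/|S| − x_T/x_S)² + β·x_T·(1 − x_T/x_S) + α·|T|·(1 − |T|/|S|)`. -/
theorem variance_dasymetric
    {Ω : Type*} [MeasureSpace Ω] [IsProbabilityMeasure (ℙ : Measure Ω)]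
    (α β aS xS aT xT : ℝ)
    (hα : 0 ≤ α) (hβ : 0 ≤ β) (haS : 0 < aS) (hxS : 0 < xS)
    (haT0 : 0 ≤ aT) (haTS : aT ≤ aS) (hxT0 : 0 ≤ xT) (hxTS : xT ≤ xS)
    (hlamT : 0 < α * aT + β * xT)
    (hlamST : 0 < (α * aS + β * xS) - (α * aT + β * xT))
    (YT YSc : Ω → ℕ) (hYTm : Measurable YT) (hYScm : Measurable YSc)
    (hindep : IndepFun YT YSc)
    (hYTd : Measure.map YT ℙ = poissonMeasure (α * aT + β * xT).toNNReal)
    (hYScd : Measure.map YSc ℙ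
      = poissonMeasure ((α * aS + β * xS) - (α * aT + β * xT)).toNNReal) :
    variance (fun ω => (xT / xS) * ((YT ω : ℝ) + (YSc ω : ℝ)) - (YT ω : ℝ)) ℙ
      = α * aS * (aT / aS - xT / xS) ^ 2 + β * xT * (1 - xT / xS)
        + α * aT * (1 - aT / aS) := by
  have hcomb : (fun ω ↦ (xT / xS) * ((YT ω : ℝ) + (YSc ω : ℝ)) - (YT ω : ℝ)) =
      fun ω ↦ (xT / xS - 1) * (YT ω : ℝ) + (xT / xS) * (YSc ω : ℝ) := by
    ext ω; ring
  have hind : IndepFun (fun ω ↦ (xT / xS - 1) * (YT ω : ℝ))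
      (fun ω ↦ (xT / xS) * (YSc ω : ℝ)) :=
    hindep.comp (φ := fun n : ℕ ↦ (xT / xS - 1) * (n : ℝ))
      (ψ := fun n : ℕ ↦ (xT / xS) * (n : ℝ)) .of_discrete .of_discrete
  rw [hcomb, hind.variance_fun_add
      ((memLp_two_of_map_eq_poissonMeasure hYTm hYTd).const_mul _)
      ((memLp_two_of_map_eq_poissonMeasure hYScm hYScd).const_mul _),
    variance_const_mul, variance_const_mul, variance_of_map_eq_poissonMeasure hYTm hYTd,
    variance_of_map_eq_poissonMeasure hYScm hYScd, Real.coe_toNNReal _ hlamT.le,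
    Real.coe_toNNReal _ hlamST.le]
  field_simp
  ring
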